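/- For the complex Bohnenblust–Hille constants C, the sequence m ↦ C_m/C_{m−1} (m ≥ 2) converges to 1 as m → ∞. -/

import Mathlib

open Real Filter

/-- The Khinchine-inequality constant `A_p = √2 · (Γ((p+1)/2)/√π)^(1/p)`. -/
noncomputable def khinchineA (p : ℝ) : ℝ :=
  Real.sqrt 2 * (Real.Gamma ((p + 1) / 2) / Real.sqrt π) ^ (1 / p)

/-- The complex Bohnenblust–Hille constants: `C 1 = 1`, `C m = (2/√π)^(m−1)` for
`2 ≤ m ≤ 6`, `C m = C (m/2) / A_{2m/(m+2)}^(m/2)` for even `m ≥ 8`, and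
`C m = (C ((m−1)/2) / A_{(2m−2)/(m+1)}^((m+1)/2))^((m−1)/(2m)) ·
       (C ((m+1)/2) / A_{(2m+2)/(m+3)}^((m−1)/2))^((m+1)/(2m))` for odd `m ≥ 7`. -/
noncomputable def bhConstC : ℕ → ℝ
  | m =>
    if _h1 : m ≤ 1 then 1
    else if _h2 : m ≤ 6 then (2 / Real.sqrt π) ^ ((m : ℝ) - 1)
    else if _h3 : m % 2 = 0 then
      bhConstC (m / 2) / khinchineA (2 * (m : ℝ) / ((m : ℝ) + 2)) ^ ((m : ℝ) / 2)
    else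
      (bhConstC ((m - 1) / 2) /
          khinchineA ((2 * (m : ℝ) - 2) / ((m : ℝ) + 1)) ^ (((m : ℝ) + 1) / 2)) ^
        (((m : ℝ) - 1) / (2 * (m : ℝ))) *
      (bhConstC ((m + 1) / 2) /
          khinchineA ((2 * (m : ℝ) + 2) / ((m : ℝ) + 3)) ^ (((m : ℝ) - 1) / 2)) ^
        (((m : ℝ) + 1) / (2 * (m : ℝ)))
  termination_by m => m
  decreasing_by all_goals omega

lemma khA_pos {p : ℝ} (hp : 0 < p) : 0 < khinchineA p := by
  unfold khinchineA
  have h1 : 0 < Real.Gamma ((p + 1) / 2) := Real.Gamma_pos_of_pos (by linarith)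
  have h2 : 0 < π := Real.pi_pos
  positivity

lemma bh_pos (m : ℕ) : 0 < bhConstC m := by
  induction m using Nat.strong_induction_on with
  | _ m ih =>
    rw [bhConstC]
    split_ifs with h1 h2 h3
    · exact one_pos
    · have h2 : 0 < π := Real.pi_pos
      positivity
    · have hm : (7 : ℝ) ≤ m := by exact_mod_cast (by omega : 7 ≤ m)
      exact div_pos (ih _ (by omega)) (Real.rpow_pos_of_pos (khA_pos (by positivity)) _)
    · have hm : (7 : ℝ) ≤ m := by exact_mod_cast (by omega : 7 ≤ m)
      refine mul_pos (Real.rpow_pos_of_pos (div_pos (ih _ (by omega))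
        (Real.rpow_pos_of_pos (khA_pos ?_) _)) _) (Real.rpow_pos_of_pos (div_pos (ih _ (by omega))
        (Real.rpow_pos_of_pos (khA_pos ?_) _)) _)
      · apply div_pos <;> linarith
      · apply div_pos <;> linarith

/-- `a k = log A_{2k/(k+1)}`. -/
noncomputable def bhA (k : ℕ) : ℝ := Real.log (khinchineA (2 * (k : ℝ) / ((k : ℝ) + 1)))

lemma bh_even (k : ℕ) (hk : 4 ≤ k) :
    Real.log (bhConstC (2 * k)) = Real.log (bhConstC k) - k * bhA k := by
  have hk' : (4 : ℝ) ≤ k := by exact_mod_cast hk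
  have hA : 0 < khinchineA (2 * (k : ℝ) / ((k : ℝ) + 1)) := khA_pos (by positivity)
  rw [bhConstC, dif_neg (by omega), dif_neg (by omega), dif_pos (by omega)]
  have e0 : 2 * k / 2 = k := by omega
  have e1 : 2 * ((2 * k : ℕ) : ℝ) / (((2 * k : ℕ) : ℝ) + 2) = 2 * (k : ℝ) / ((k : ℝ) + 1) := by
    push_cast
    field_simp
  have e2 : ((2 * k : ℕ) : ℝ) / 2 = k := by
    push_cast
    ring
  rw [e0, e1, e2, Real.log_div (bh_pos k).ne' (Real.rpow_pos_of_pos hA _).ne',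
    Real.log_rpow hA, bhA]

lemma bh_odd (k : ℕ) (hk : 3 ≤ k) :
    Real.log (bhConstC (2 * k + 1)) =
      k / (2 * k + 1) * (Real.log (bhConstC k) - (k + 1) * bhA k) +
      (k + 1) / (2 * k + 1) * (Real.log (bhConstC (k + 1)) - k * bhA (k + 1)) := by
  have hk' : (3 : ℝ) ≤ k := by exact_mod_cast hk
  have hA : 0 < khinchineA (2 * (k : ℝ) / ((k : ℝ) + 1)) := khA_pos (by positivity)
  have hB : 0 < khinchineA (2 * ((k + 1 : ℕ) : ℝ) / (((k + 1 : ℕ) : ℝ) + 1)) :=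
    khA_pos (by positivity)
  rw [bhConstC, dif_neg (by omega), dif_neg (by omega), dif_neg (by omega)]
  have e0 : (2 * k + 1 - 1) / 2 = k := by omega
  have e0' : (2 * k + 1 + 1) / 2 = k + 1 := by omega
  have e1 : (2 * ((2 * k + 1 : ℕ) : ℝ) - 2) / (((2 * k + 1 : ℕ) : ℝ) + 1)
      = 2 * (k : ℝ) / ((k : ℝ) + 1) := by
    push_cast
    rw [div_eq_div_iff (by positivity) (by positivity)]
    ring
  have e1' : (2 * ((2 * k + 1 : ℕ) : ℝ) + 2) / (((2 * k + 1 : ℕ) : ℝ) + 3)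
      = 2 * ((k + 1 : ℕ) : ℝ) / (((k + 1 : ℕ) : ℝ) + 1) := by
    push_cast
    rw [div_eq_div_iff (by positivity) (by positivity)]
    ring
  have e2 : (((2 * k + 1 : ℕ) : ℝ) + 1) / 2 = k + 1 := by
    push_cast
    ring
  have e2' : (((2 * k + 1 : ℕ) : ℝ) - 1) / 2 = k := by
    push_cast
    ring
  have e3 : (((2 * k + 1 : ℕ) : ℝ) - 1) / (2 * ((2 * k + 1 : ℕ) : ℝ)) = k / (2 * k + 1) := by
    push_cast
    rw [div_eq_div_iff (by positivity) (by positivity)]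
    ring
  have e3' : (((2 * k + 1 : ℕ) : ℝ) + 1) / (2 * ((2 * k + 1 : ℕ) : ℝ))
      = (k + 1) / (2 * k + 1) := by
    push_cast
    rw [div_eq_div_iff (by positivity) (by positivity)]
    ring
  rw [e0, e0', e1, e1', e2, e2', e3, e3']
  have p1 := div_pos (bh_pos k) (Real.rpow_pos_of_pos hA ((k : ℝ) + 1))
  have p2 := div_pos (bh_pos (k + 1)) (Real.rpow_pos_of_pos hB (k : ℝ))
  rw [Real.log_mul (Real.rpow_pos_of_pos p1 _).ne' (Real.rpow_pos_of_pos p2 _).ne',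
    Real.log_rpow p1, Real.log_rpow p2,
    Real.log_div (bh_pos _).ne' (Real.rpow_pos_of_pos hA _).ne',
    Real.log_div (bh_pos _).ne' (Real.rpow_pos_of_pos hB _).ne',
    Real.log_rpow hA, Real.log_rpow hB, bhA, bhA]

lemma khA_two : Real.log (khinchineA 2) = 0 := by
  have h : Real.Gamma ((2 + 1) / 2) = 1 / 2 * √π := by
    have : ((2 : ℝ) + 1) / 2 = 1 / 2 + 1 := by norm_num
    rw [this, Real.Gamma_add_one (by norm_num), Real.Gamma_one_half_eq]
  have hp : √π ≠ 0 := (Real.sqrt_pos.2 Real.pi_pos).ne'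
  rw [khinchineA, h, mul_div_assoc, div_self hp, mul_one, ← Real.sqrt_eq_rpow,
    ← Real.sqrt_mul (by norm_num)]
  norm_num

lemma khA_diff : DifferentiableAt ℝ (fun p => Real.log (khinchineA p)) 2 := by
  have hG : DifferentiableAt ℝ (fun p : ℝ => Real.Gamma ((p + 1) / 2)) 2 := by
    apply DifferentiableAt.comp (g := Real.Gamma) (f := fun p : ℝ => (p + 1) / 2)
    · apply Real.differentiableAt_Gamma
      intro m h
      have : (0 : ℝ) ≤ m := Nat.cast_nonneg m
      norm_num at h
      linarith
    · fun_prop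
  have hp : √π ≠ 0 := (Real.sqrt_pos.2 Real.pi_pos).ne'
  have h1 : DifferentiableAt ℝ khinchineA 2 := by
    unfold khinchineA
    apply DifferentiableAt.const_mul
    apply DifferentiableAt.rpow
    · exact hG.div_const _
    · apply DifferentiableAt.div <;> first | fun_prop | norm_num
    · exact div_ne_zero (Real.Gamma_pos_of_pos (by norm_num)).ne' hp
  exact h1.log (khA_pos (by norm_num)).ne'

lemma bhA_tendsto : ∃ c : ℝ, Tendsto (fun k : ℕ => (k : ℝ) * bhA k) atTop (nhds c) := by
  have hd : DifferentiableAt ℝ (fun x : ℝ => Real.log (khinchineA (2 - 2 * x))) 0 := by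
    apply DifferentiableAt.comp (g := fun p => Real.log (khinchineA p))
      (f := fun x : ℝ => 2 - 2 * x)
    · simpa using khA_diff
    · fun_prop
  obtain ⟨c, hc⟩ : ∃ c, HasDerivAt (fun x : ℝ => Real.log (khinchineA (2 - 2 * x))) c 0 :=
    ⟨_, hd.hasDerivAt⟩
  refine ⟨c, ?_⟩
  have hs := hc.tendsto_slope
  have ht : Tendsto (fun k : ℕ => 1 / ((k : ℝ) + 1)) atTop (nhdsWithin 0 {0}ᶜ) := by
    refine tendsto_nhdsWithin_iff.2 ⟨tendsto_one_div_add_atTop_nhds_zero_nat, ?_⟩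
    refine Eventually.of_forall fun k => ?_
    have : (0 : ℝ) < 1 / ((k : ℝ) + 1) := by positivity
    exact this.ne'
  have h1 := hs.comp ht
  have h2 := h1.mul (tendsto_natCast_div_add_atTop (1 : ℝ))
  rw [mul_one] at h2
  refine h2.congr fun k => ?_
  have hk : (k : ℝ) + 1 ≠ 0 := by positivity
  have e : 2 - 2 * (1 / ((k : ℝ) + 1)) = 2 * k / (k + 1) := by
    field_simp
    ring
  simp only [Function.comp, slope_def_field, e, mul_zero, sub_zero, khA_two, bhA]
  field_simp

lemma contraction (D ε : ℕ → ℝ) (hε : Tendsto ε atTop (nhds 0))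
    (h1 : ∀ k, 4 ≤ k → |D (2 * k + 1)| ≤ 2 / 3 * |D (k + 1)| + ε k)
    (h2 : ∀ k, 4 ≤ k → |D (2 * k + 2)| ≤ 2 / 3 * |D (k + 1)| + ε k) :
    Tendsto D atTop (nhds 0) := by
  have h : ∀ m, 9 ≤ m → |D m| ≤ 2 / 3 * |D ((m - 1) / 2 + 1)| + ε ((m - 1) / 2) := by
    intro m hm
    rcases Nat.even_or_odd' m with ⟨j, rfl | rfl⟩
    · have e : 2 * j = 2 * ((2 * j - 1) / 2) + 2 := by omega
      have := h2 ((2 * j - 1) / 2) (by omega)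
      rwa [← e] at this
    · have e : 2 * j + 1 = 2 * ((2 * j + 1 - 1) / 2) + 1 := by omega
      have := h1 ((2 * j + 1 - 1) / 2) (by omega)
      rwa [← e] at this
  rw [Metric.tendsto_atTop]
  intro δ' hδ'
  obtain ⟨δ, hδ, hδδ⟩ : ∃ δ : ℝ, 0 < δ ∧ δ' = 2 * δ := ⟨δ' / 2, by linarith, by ring⟩
  obtain ⟨K, hK⟩ := eventually_atTop.1 (hε.eventually (gt_mem_nhds (show (0 : ℝ) < δ / 3 by linarith)))
  set B : ℝ := ∑ i ∈ Finset.range (2 * K + 10), |D i| with hB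
  have hB0 : 0 ≤ B := Finset.sum_nonneg fun i _ => abs_nonneg _
  have hP0 : ∀ m, |D m| ≤ B + δ := by
    intro m
    induction m using Nat.strong_induction_on with
    | _ m ih =>
      by_cases hm : m < 2 * K + 10
      · have := Finset.single_le_sum (f := fun i => |D i|) (fun i _ => abs_nonneg _)
          (Finset.mem_range.2 hm)
        linarith
      · have a1 := h m (by omega)
        have a2 := ih ((m - 1) / 2 + 1) (by omega)
        have a3 := hK ((m - 1) / 2) (by omega)
        linarith
  have hP : ∀ j : ℕ, ∃ N, ∀ m ≥ N, |D m| ≤ B * (2 / 3) ^ j + δ := by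
    intro j
    induction j with
    | zero => exact ⟨0, fun m _ => by simpa using hP0 m⟩
    | succ j ih =>
      obtain ⟨N, hN⟩ := ih
      refine ⟨2 * N + 2 * K + 10, fun m hm => ?_⟩
      have a1 := h m (by omega)
      have a2 := hN ((m - 1) / 2 + 1) (by omega)
      have a3 := hK ((m - 1) / 2) (by omega)
      rw [pow_succ]
      linarith
  have hlim : Tendsto (fun j : ℕ => B * (2 / 3 : ℝ) ^ j) atTop (nhds (B * 0)) :=
    (tendsto_pow_atTop_nhds_zero_of_lt_one (by norm_num) (by norm_num)).const_mul B
  rw [mul_zero] at hlim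
  obtain ⟨j, hj⟩ := (hlim.eventually (gt_mem_nhds hδ)).exists
  obtain ⟨N, hN⟩ := hP j
  refine ⟨N, fun m hm => ?_⟩
  have := hN m hm
  rw [Real.dist_eq, sub_zero]
  linarith

lemma step_bound {s x y e : ℝ} (hs0 : 0 ≤ s) (hs : s ≤ 2 / 3) (t : ℝ) (ht0 : 0 ≤ t) (ht : t ≤ 1)
    (h : e = s * x - t * y) : |e| ≤ 2 / 3 * |x| + |y| := by
  rw [h]
  refine (abs_sub _ _).trans ?_
  rw [abs_mul, abs_mul, abs_of_nonneg hs0, abs_of_nonneg ht0]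
  have := mul_le_mul_of_nonneg_right hs (abs_nonneg x)
  have := mul_le_mul_of_nonneg_right ht (abs_nonneg y)
  linarith

lemma bh_logdiff : Tendsto (fun m : ℕ => Real.log (bhConstC m) - Real.log (bhConstC (m - 1)))
    atTop (nhds 0) := by
  obtain ⟨c, hc⟩ := bhA_tendsto
  have hc' := (hc.comp (tendsto_add_atTop_nat 1)).sub hc
  rw [sub_self] at hc'
  have hε := hc'.abs
  rw [abs_zero] at hε
  refine contraction _ _ hε ?_ ?_
  · intro k hk
    have hk' : (4 : ℝ) ≤ k := by exact_mod_cast hk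
    have ho := bh_odd k (by omega)
    have he := bh_even k hk
    have hp : (0 : ℝ) < 2 * k + 1 := by positivity
    refine step_bound (s := (k + 1) / (2 * k + 1)) (by positivity) ?_
      (k / (2 * k + 1)) (by positivity) ?_ ?_
    · rw [div_le_div_iff₀ hp (by norm_num)]; linarith
    · rw [div_le_one hp]; linarith
    · have e : 2 * k + 1 - 1 = 2 * k := by omega
      have e' : k + 1 - 1 = k := by omega
      simp only [Function.comp]
      rw [e, e', ho, he]
      push_cast
      field_simp
      ring
  · intro k hk
    have hk' : (4 : ℝ) ≤ k := by exact_mod_cast hk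
    have ho := bh_odd k (by omega)
    have he := bh_even (k + 1) (by omega)
    have hp : (0 : ℝ) < 2 * k + 1 := by positivity
    refine step_bound (s := k / (2 * k + 1)) (by positivity) ?_
      ((k + 1) / (2 * k + 1)) (by positivity) ?_ ?_
    · rw [div_le_div_iff₀ hp (by norm_num)]; linarith
    · rw [div_le_one hp]; linarith
    · have e : 2 * k + 2 - 1 = 2 * k + 1 := by omega
      have e' : k + 1 - 1 = k := by omega
      have e'' : 2 * k + 2 = 2 * (k + 1) := by omega
      simp only [Function.comp]
      rw [e, e', ho, e'', he]
      push_cast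
      field_simp
      ring

/-- The asymptotic growth of the complex Bohnenblust–Hille constants is optimal:
`C_m/C_{m−1} → 1`. -/
theorem bhConstC_ratio_tendsto_one :
    Tendsto (fun m : ℕ => bhConstC m / bhConstC (m - 1)) atTop (nhds 1) := by
  have h := (Real.continuous_exp.tendsto 0).comp bh_logdiff
  rw [Real.exp_zero] at h
  refine h.congr fun m => ?_
  simp only [Function.comp]
  rw [Real.exp_sub, Real.exp_log (bh_pos _), Real.exp_log (bh_pos _)]
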